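/- Fix N ≥ 2 and a constant unitary U ∈ U(N). Let u = (u_1, …, u_{N−1})^t : M^{1+m} → ℂ^{N−1} be smooth and P := U P_0(u) U†. Then P satisfies the equations of motion [P, □P] = 0 of the ℂP^{N−1} sigma model if and only if u satisfies (1 + u†u) ∂^μ∂_μ u − 2 (u† ∂_μu) ∂^μu = 0. -/

import Mathlib

/-!
`(1+m)`-dimensional Minkowski space `M^{1+m}` is modeled as `Fin (m+1) → ℝ` with
coordinates `x 0, x 1, ..., x m` and metric `η = diag(1, -1, ..., -1)`.
`pd μ f` is the partial derivative `∂_μ f`, `pdM` its entrywise matrix version,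
`boxS`/`boxM` the d'Alembertian `□ = ∂_0² - Σ_{k=1}^m ∂_k²`, and contractions over a
repeated index `μ` are written as `∑ μ, eta μ * ⋯` (resp. `eta μ • ⋯`).
-/

noncomputable section
open Matrix
open scoped Kronecker

/-- `(1+m)`-dimensional Minkowski spacetime. -/
abbrev Spacetime (m : ℕ) := Fin (m + 1) → ℝ

/-- Partial derivative `∂_μ`. -/
def pd {m : ℕ} {E : Type*} [NormedAddCommGroup E] [NormedSpace ℝ E]
    (μ : Fin (m + 1)) (f : Spacetime m → E) : Spacetime m → E :=
  fun x => fderiv ℝ f x (Pi.single μ 1)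

/-- Entrywise partial derivative `∂_μ` of a matrix-valued function. -/
def pdM {m : ℕ} {ι κ : Type*} (μ : Fin (m + 1)) (P : Spacetime m → Matrix ι κ ℂ) :
    Spacetime m → Matrix ι κ ℂ :=
  fun x => Matrix.of fun i j => pd μ (fun y => P y i j) x

/-- The Minkowski signature `η = diag(1, -1, …, -1)` as a complex scalar:
raising an index costs `eta μ`. -/
def eta {m : ℕ} (μ : Fin (m + 1)) : ℂ := if μ = 0 then 1 else -1

/-- d'Alembertian `□ = ∂^μ∂_μ` on scalar functions. -/
def boxS {m : ℕ} (f : Spacetime m → ℂ) : Spacetime m → ℂ :=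
  fun x => ∑ μ, eta μ * pd μ (pd μ f) x

/-- d'Alembertian `□ = ∂^μ∂_μ` on matrix-valued functions. -/
def boxM {m : ℕ} {ι κ : Type*} (P : Spacetime m → Matrix ι κ ℂ) :
    Spacetime m → Matrix ι κ ℂ :=
  fun x => ∑ μ, eta μ • pdM μ (pdM μ P) x

/-- The block matrix `V(Z) = [[I, -Z†],[Z, I]]` on `ℂ^n ⊕ ℂ^p`. -/
def Vmat {n p : ℕ} (Z : Matrix (Fin p) (Fin n) ℂ) :
    Matrix (Fin n ⊕ Fin p) (Fin n ⊕ Fin p) ℂ :=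
  Matrix.fromBlocks 1 (-Zᴴ) Z 1

/-- The block matrix `W(Z) = [[I, Z†],[-Z, I]]` on `ℂ^n ⊕ ℂ^p`. -/
def Wmat {n p : ℕ} (Z : Matrix (Fin p) (Fin n) ℂ) :
    Matrix (Fin n ⊕ Fin p) (Fin n ⊕ Fin p) ℂ :=
  Matrix.fromBlocks 1 Zᴴ (-Z) 1

/-- The projector `P₀(Z) = V(Z) · diag(I_n, 0_p) · V(Z)⁻¹`. -/
def P0 {n p : ℕ} (Z : Matrix (Fin p) (Fin n) ℂ) :
    Matrix (Fin n ⊕ Fin p) (Fin n ⊕ Fin p) ℂ :=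
  Vmat Z * Matrix.fromBlocks 1 0 0 0 * (Vmat Z)⁻¹

/-- Entrywise smoothness of a matrix-valued function. -/
def SmM {m : ℕ} {ι κ : Type*} (f : Spacetime m → Matrix ι κ ℂ) : Prop :=
  ∀ i j, ContDiff ℝ (⊤ : ℕ∞) fun x => f x i j

lemma SmM.mul {m : ℕ} {ι κ l : Type*} [Fintype κ] {f : Spacetime m → Matrix ι κ ℂ}
    {g : Spacetime m → Matrix κ l ℂ} (hf : SmM f) (hg : SmM g) :
    SmM (fun x => f x * g x) := by
  intro i j
  simp only [Matrix.mul_apply]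
  exact ContDiff.sum fun k _ => (hf i k).mul (hg k j)

lemma SmM.const {m : ℕ} {ι κ : Type*} (A : Matrix ι κ ℂ) : SmM (fun _ : Spacetime m => A) :=
  fun _ _ => contDiff_const

lemma SmM.conj {m : ℕ} {ι κ : Type*} {f : Spacetime m → Matrix ι κ ℂ} (hf : SmM f) :
    SmM (fun x => (f x)ᴴ) := by
  intro i j
  simp only [Matrix.conjTranspose_apply]
  exact Complex.conjCLE.contDiff.comp (hf j i)

lemma SmM.pdM {m : ℕ} {ι κ : Type*} {f : Spacetime m → Matrix ι κ ℂ} (hf : SmM f)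
    (μ : Fin (m + 1)) : SmM (pdM μ f) := by
  intro i j
  have h : ContDiff ℝ (⊤ : ℕ∞) (fderiv ℝ (fun x => f x i j)) :=
    (hf i j).fderiv_right (by simp)
  exact h.clm_apply contDiff_const

lemma SmM.diff {m : ℕ} {ι κ : Type*} {f : Spacetime m → Matrix ι κ ℂ} (hf : SmM f)
    (i : ι) (j : κ) (x : Spacetime m) : DifferentiableAt ℝ (fun x => f x i j) x :=
  ((hf i j).differentiable (by simp)) x

lemma pdM_mul {m : ℕ} {ι κ l : Type*} [Fintype κ] {f : Spacetime m → Matrix ι κ ℂ}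
    {g : Spacetime m → Matrix κ l ℂ} (hf : SmM f) (hg : SmM g) (μ : Fin (m + 1)) :
    pdM μ (fun x => f x * g x) = fun x => pdM μ f x * g x + f x * pdM μ g x := by
  funext x
  ext i j
  simp only [pdM, pd, Matrix.of_apply, Matrix.add_apply, Matrix.mul_apply]
  rw [fderiv_fun_sum (fun k _ => (hf.diff i k x).fun_mul (hg.diff k j x))]
  rw [_root_.sum_apply, ← Finset.sum_add_distrib]
  refine Finset.sum_congr rfl fun k _ => ?_
  rw [fderiv_fun_mul (hf.diff i k x) (hg.diff k j x)]
  simp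
  ring

lemma pdM_add {m : ℕ} {ι κ : Type*} {f g : Spacetime m → Matrix ι κ ℂ}
    (hf : SmM f) (hg : SmM g) (μ : Fin (m + 1)) :
    pdM μ (fun x => f x + g x) = fun x => pdM μ f x + pdM μ g x := by
  funext x
  ext i j
  simp only [pdM, pd, Matrix.of_apply, Matrix.add_apply]
  rw [fderiv_fun_add (hf.diff i j x) (hg.diff i j x)]
  simp

lemma pdM_const {m : ℕ} {ι κ : Type*} (A : Matrix ι κ ℂ) (μ : Fin (m + 1)) :
    pdM μ (fun _ : Spacetime m => A) = fun _ => 0 := by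
  funext x
  ext i j
  simp [pdM, pd]

lemma pdM_const_mul {m : ℕ} {ι κ l : Type*} [Fintype κ] (A : Matrix ι κ ℂ)
    {g : Spacetime m → Matrix κ l ℂ} (hg : SmM g) (μ : Fin (m + 1)) :
    pdM μ (fun x => A * g x) = fun x => A * pdM μ g x := by
  rw [pdM_mul (SmM.const A) hg, pdM_const]
  simp

lemma pdM_conj {m : ℕ} {ι κ : Type*} {f : Spacetime m → Matrix ι κ ℂ} (hf : SmM f)
    (μ : Fin (m + 1)) : pdM μ (fun x => (f x)ᴴ) = fun x => (pdM μ f x)ᴴ := by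
  funext x
  ext i j
  simp only [pdM, pd, Matrix.of_apply, Matrix.conjTranspose_apply]
  have h := (Complex.conjCLE.toContinuousLinearMap.hasFDerivAt.comp x
    (hf.diff j i x).hasFDerivAt).fderiv
  have h2 := congrArg (fun L => L (Pi.single μ 1)) h
  exact h2

lemma mul_one_one {ι : Type*} (M : Matrix ι (Fin 1) ℂ) (K : Matrix (Fin 1) (Fin 1) ℂ) :
    M * K = K 0 0 • M := by
  ext i j
  fin_cases j
  simp [Matrix.mul_apply]
  exact mul_comm _ _

/-- The homogeneous vector `(1, u)`. -/
def hv {p : ℕ} (a : Matrix (Fin p) (Fin 1) ℂ) : Matrix (Fin 1 ⊕ Fin p) (Fin 1) ℂ :=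
  Matrix.fromRows 1 a

/-- The vector `(0, b)`. -/
def zr {p : ℕ} (b : Matrix (Fin p) (Fin 1) ℂ) : Matrix (Fin 1 ⊕ Fin p) (Fin 1) ℂ :=
  Matrix.fromRows 0 b

lemma s_ne {p : ℕ} (a : Matrix (Fin p) (Fin 1) ℂ) : (1 + (aᴴ * a) 0 0) ≠ 0 := by
  have : (1 + (aᴴ * a) 0 0) = ((1 + ∑ i, Complex.normSq (a i 0) : ℝ) : ℂ) := by
    simp [Matrix.mul_apply, Complex.normSq_eq_conj_mul_self]
  rw [this]
  have h : (0 : ℝ) ≤ ∑ i, Complex.normSq (a i 0) :=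
    Finset.sum_nonneg fun i _ => Complex.normSq_nonneg _
  exact_mod_cast (by linarith : (1 + ∑ i, Complex.normSq (a i 0) : ℝ) > 0).ne'

lemma s_P0 {p : ℕ} (a : Matrix (Fin p) (Fin 1) ℂ) :
    (1 + (aᴴ * a) 0 0) • P0 a = hv a * (hv a)ᴴ := by
  have hdet : IsUnit (Vmat a).det := by
    rw [Vmat, Matrix.det_fromBlocks_one₂₂]
    simpa using s_ne a
  have key : hv a * (hv a)ᴴ * Vmat a =
      (1 + (aᴴ * a) 0 0) • (Vmat a * Matrix.fromBlocks 1 0 0 0) := by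
    have h1 : (hv a)ᴴ * Vmat a = Matrix.fromCols (1 + aᴴ * a) 0 := by
      rw [hv, Vmat, Matrix.conjTranspose_fromRows_eq_fromCols_conjTranspose,
        Matrix.fromCols_mul_fromBlocks]
      simp
    rw [Matrix.mul_assoc, h1, hv, Vmat, Matrix.fromRows_mul_fromCols, Matrix.fromBlocks_multiply,
      Matrix.fromBlocks_smul]
    simp only [mul_one_one _ (1 + aᴴ * a)]
    simp
  rw [P0, ← Matrix.smul_mul, ← key, Matrix.mul_assoc, Matrix.mul_nonsing_inv _ hdet,
    Matrix.mul_one]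

lemma pdM_hv {m p : ℕ} (u : Spacetime m → Matrix (Fin p) (Fin 1) ℂ) (μ : Fin (m + 1)) :
    pdM μ (fun x => hv (u x)) = fun x => zr (pdM μ u x) := by
  funext x
  ext i j
  rcases i with i | i <;> simp [pdM, pd, hv, zr]

lemma pdM_z {m p : ℕ} (u : Spacetime m → Matrix (Fin p) (Fin 1) ℂ) (μ : Fin (m + 1)) :
    pdM μ (fun x => zr (u x))
      = fun x => zr (pdM μ u x) := by
  funext x
  ext i j
  rcases i with i | i <;> simp [pdM, pd, zr]

lemma hv_mul {p : ℕ} (a b : Matrix (Fin p) (Fin 1) ℂ) :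
    (hv a)ᴴ * zr b = aᴴ * b := by
  rw [hv, zr, Matrix.conjTranspose_fromRows_eq_fromCols_conjTranspose,
    Matrix.fromCols_mul_fromRows]
  simp

lemma hv_hv {p : ℕ} (a : Matrix (Fin p) (Fin 1) ℂ) :
    (hv a)ᴴ * hv a = 1 + aᴴ * a := by
  rw [hv, Matrix.conjTranspose_fromRows_eq_fromCols_conjTranspose, Matrix.fromCols_mul_fromRows]
  simp

theorem statement9 {m p : ℕ} (hp : 0 < p)
    (U : Matrix (Fin 1 ⊕ Fin p) (Fin 1 ⊕ Fin p) ℂ)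
    (hU : U ∈ Matrix.unitaryGroup (Fin 1 ⊕ Fin p) ℂ)
    (u : Spacetime m → Matrix (Fin p) (Fin 1) ℂ)
    (hu : ∀ i j, ContDiff ℝ (⊤ : ℕ∞) fun x => u x i j)
    (P : Spacetime m → Matrix (Fin 1 ⊕ Fin p) (Fin 1 ⊕ Fin p) ℂ)
    (hP : ∀ x, P x = U * P0 (u x) * Uᴴ) :
    (∀ x, P x * boxM P x - boxM P x * P x = 0)
      ↔ (∀ x, (1 + ((u x)ᴴ * u x) 0 0) • boxM u x
          - (2 : ℂ) • ∑ μ, eta μ • (((u x)ᴴ * pdM μ u x) 0 0 • pdM μ u x) = 0) := by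
  have hUU : Uᴴ * U = 1 := (Matrix.mem_unitaryGroup_iff').1 hU
  have hUU' : ∀ {k : Type} (M : Matrix (Fin 1 ⊕ Fin p) k ℂ), Uᴴ * (U * M) = M := by
    intro k M
    rw [← Matrix.mul_assoc, hUU, Matrix.one_mul]
  have hu' : SmM u := hu
  have hvS : SmM (fun x => hv (u x)) := by
    intro i j
    rcases i with i | i
    · simpa [hv] using contDiff_const
    · simpa [hv] using hu i j
  obtain ⟨w, hw⟩ : ∃ w : Spacetime m → Matrix (Fin 1 ⊕ Fin p) (Fin 1) ℂ,
    w = fun x => U * hv (u x) := ⟨_, rfl⟩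
  have hwS : SmM w := by rw [hw]; exact (SmM.const U).mul hvS
  obtain ⟨s, hs⟩ : ∃ s : Spacetime m → ℂ, s = fun x => 1 + ((u x)ᴴ * u x) 0 0 := ⟨_, rfl⟩
  have hs0 : ∀ x, s x ≠ 0 := fun x => by rw [hs]; exact s_ne _
  have hsP : ∀ x, s x • P x = w x * (w x)ᴴ := by
    intro x
    rw [hP, hw, hs]
    simp only [Matrix.conjTranspose_mul]
    rw [← Matrix.smul_mul, ← Matrix.mul_smul, s_P0]
    simp only [Matrix.mul_assoc]
  have hPw' : ∀ x, P x = (s x)⁻¹ • (w x * (w x)ᴴ) := by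
    intro x
    rw [← hsP, smul_smul, inv_mul_cancel₀ (hs0 x), one_smul]
  have hww : ∀ x, ((w x)ᴴ * w x) 0 0 = s x := by
    intro x
    rw [hw, hs]
    simp only [Matrix.conjTranspose_mul, Matrix.mul_assoc, hUU']
    rw [hv_hv]
    simp
  have hPw : ∀ x, P x * w x = w x := by
    intro x
    rw [hPw', Matrix.smul_mul, Matrix.mul_assoc, mul_one_one, hww, smul_smul,
      inv_mul_cancel₀ (hs0 x), one_smul]
  have hPP : ∀ x, P x * P x = P x := by
    intro x
    have h : P x * ((s x)⁻¹ • (w x * (w x)ᴴ)) = (s x)⁻¹ • (w x * (w x)ᴴ) := by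
      rw [Matrix.mul_smul, ← Matrix.mul_assoc, hPw]
    rwa [← hPw' x] at h
  have hsc : ∀ x, star (s x) = s x := by
    intro x
    rw [← hww, ← Matrix.conjTranspose_apply, Matrix.conjTranspose_mul,
      Matrix.conjTranspose_conjTranspose]
  have hPH : ∀ x, (P x)ᴴ = P x := by
    intro x
    rw [hPw', Matrix.conjTranspose_smul, star_inv₀, hsc]
    simp
  have hsS : ContDiff ℝ (⊤ : ℕ∞) s := by
    rw [hs]
    exact contDiff_const.add ((hu'.conj.mul hu') 0 0)
  have hPS : SmM P := by
    intro i j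
    have h1 := (hsS.inv hs0).mul ((hwS.mul hwS.conj) i j)
    have h2 : (fun x => P x i j) = fun x => (s x)⁻¹ * (w x * (w x)ᴴ) i j := by
      funext x
      rw [hPw']
      simp
    rw [h2]
    exact h1
  -- first-order identities
  have d1 : ∀ μ x, pdM μ P x * w x + P x * pdM μ w x = pdM μ w x := by
    intro μ x
    have h := pdM_mul hPS hwS μ
    rw [show (fun x => P x * w x) = w from funext hPw] at h
    exact (congrFun h x).symm
  have d2 : ∀ μ x, pdM μ P x * P x + P x * pdM μ P x = pdM μ P x := by
    intro μ x
    have h := pdM_mul hPS hPS μ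
    rw [show (fun x => P x * P x) = P from funext hPP] at h
    exact (congrFun h x).symm
  have d3 : ∀ μ x, pdM μ (pdM μ P) x * w x + pdM μ P x * pdM μ w x
      + (pdM μ P x * pdM μ w x + P x * pdM μ (pdM μ w) x) = pdM μ (pdM μ w) x := by
    intro μ x
    have h := pdM_add ((hPS.pdM μ).mul hwS) (hPS.mul (hwS.pdM μ)) μ
    rw [show (fun x => pdM μ P x * w x + P x * pdM μ w x) = pdM μ w from funext (d1 μ),
      pdM_mul (hPS.pdM μ) hwS, pdM_mul hPS (hwS.pdM μ)] at h
    exact (congrFun h x).symm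
  have d4 : ∀ μ x, (pdM μ (pdM μ P) x)ᴴ = pdM μ (pdM μ P) x := by
    intro μ x
    have h := pdM_conj hPS μ
    rw [show (fun x => (P x)ᴴ) = P from funext hPH] at h
    have h2 := pdM_conj (hPS.pdM μ) μ
    rw [← h] at h2
    exact (congrFun h2 x).symm
  have hBH : ∀ x, (boxM P x)ᴴ = boxM P x := by
    intro x
    simp only [boxM, Matrix.conjTranspose_sum, Matrix.conjTranspose_smul, d4]
    refine Finset.sum_congr rfl fun μ _ => ?_
    congr 1
    unfold eta
    split_ifs <;> simp
  -- derivatives of `w`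
  have hdw : ∀ μ, pdM μ w = fun x => U * zr (pdM μ u x) := by
    intro μ
    rw [hw, pdM_const_mul U hvS, pdM_hv]
  have hzS : ∀ μ, SmM (fun x => zr (pdM μ u x)) := by
    intro μ i j
    rcases i with i | i
    · simpa [zr] using contDiff_const
    · simpa [zr] using hu'.pdM μ i j
  have hddw : ∀ μ, pdM μ (pdM μ w) = fun x => U * zr (pdM μ (pdM μ u) x) := by
    intro μ
    rw [hdw, pdM_const_mul U (hzS μ), pdM_z]
  have hwdw : ∀ μ x, ((w x)ᴴ * pdM μ w x) 0 0 = ((u x)ᴴ * pdM μ u x) 0 0 := by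
    intro μ x
    rw [hdw, hw]
    simp only [Matrix.conjTranspose_mul, Matrix.mul_assoc, hUU', hv_mul]
  have d5 : ∀ μ x, s x • ((1 - P x) * (pdM μ (pdM μ P) x * w x)) =
      (1 - P x) * (s x • pdM μ (pdM μ w) x
        - (2 : ℂ) • (((u x)ᴴ * pdM μ u x) 0 0 • pdM μ w x)) := by
    intro μ x
    have e0 : (1 - P x) * P x = 0 := by rw [Matrix.sub_mul, hPP, Matrix.one_mul, sub_self]
    have e1 : pdM μ P x * w x = (1 - P x) * pdM μ w x := by
      rw [Matrix.sub_mul, Matrix.one_mul]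
      exact eq_sub_of_add_eq (d1 μ x)
    have e2 : (1 - P x) * pdM μ P x = pdM μ P x * P x := by
      rw [Matrix.sub_mul, Matrix.one_mul]
      exact (eq_sub_of_add_eq (d2 μ x)).symm
    have e3 : s x • ((1 - P x) * (pdM μ P x * pdM μ w x)) =
        (1 - P x) * (((u x)ᴴ * pdM μ u x) 0 0 • pdM μ w x) := by
      rw [← Matrix.mul_assoc, e2, Matrix.mul_assoc, ← Matrix.mul_smul, ← Matrix.smul_mul, hsP,
        ← hwdw, ← mul_one_one, ← Matrix.mul_assoc, ← Matrix.mul_assoc, e1]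
      simp only [Matrix.mul_assoc]
    have e4 : pdM μ (pdM μ P) x * w x = pdM μ (pdM μ w) x - P x * pdM μ (pdM μ w) x
        - (2 : ℂ) • (pdM μ P x * pdM μ w x) := by
      have h := d3 μ x
      rw [two_smul, sub_sub]
      refine eq_sub_of_add_eq ?_
      refine Eq.trans ?_ h
      abel
    rw [e4, Matrix.mul_sub, Matrix.mul_sub, ← Matrix.mul_assoc, e0, Matrix.zero_mul, sub_zero,
      Matrix.mul_smul, smul_sub, smul_comm, e3, Matrix.mul_sub]
    simp only [Matrix.mul_smul]
  obtain ⟨X, hX⟩ : ∃ X : Spacetime m → Matrix (Fin p) (Fin 1) ℂ,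
    X = fun x => (1 + ((u x)ᴴ * u x) 0 0) • boxM u x
          - (2 : ℂ) • ∑ μ, eta μ • (((u x)ᴴ * pdM μ u x) 0 0 • pdM μ u x) := ⟨_, rfl⟩
  have d6 : ∀ x, s x • ((1 - P x) * (boxM P x * w x)) =
      (1 - P x) * (U * zr (X x)) := by
    intro x
    have f1 : U * zr (X x) = ∑ μ, eta μ • (s x • pdM μ (pdM μ w) x
        - (2 : ℂ) • (((u x)ᴴ * pdM μ u x) 0 0 • pdM μ w x)) := by
      have f0 : zr (X x) = ∑ μ, eta μ • (s x • zr (pdM μ (pdM μ u) x)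
          - (2 : ℂ) • (((u x)ᴴ * pdM μ u x) 0 0 • zr (pdM μ u x))) := by
        ext i j
        rcases i with i | i
        · simp [Matrix.sum_apply, zr]
        · simp only [zr, hX, hs, boxM, Matrix.sum_apply, Matrix.smul_apply, Matrix.sub_apply,
            Matrix.fromRows_apply_inr, smul_eq_mul, Finset.mul_sum, ← Finset.sum_sub_distrib]
          refine Finset.sum_congr rfl fun μ _ => ?_
          ring
      rw [f0]
      simp only [hddw, Matrix.mul_sum, Matrix.mul_smul, Matrix.mul_sub]
      simp only [hdw]
    rw [f1, boxM, Matrix.sum_mul, Matrix.mul_sum, Matrix.mul_sum, Finset.smul_sum]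
    refine Finset.sum_congr rfl fun μ _ => ?_
    rw [Matrix.mul_smul, ← d5, Matrix.smul_mul, Matrix.mul_smul, smul_comm]
  refine forall_congr' fun x => ?_
  rw [show (1 + ((u x)ᴴ * u x) 0 0) • boxM u x
          - (2 : ℂ) • ∑ μ, eta μ • (((u x)ᴴ * pdM μ u x) 0 0 • pdM μ u x) = X x by rw [hX]]
  constructor
  · intro h
    have h1 : (1 - P x) * (boxM P x * w x) = 0 := by
      rw [Matrix.sub_mul, ← Matrix.mul_assoc (P x), sub_eq_zero.1 h, Matrix.mul_assoc, hPw,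
        Matrix.one_mul, sub_self]
    have h2 := d6 x
    rw [h1, smul_zero, Matrix.sub_mul, Matrix.one_mul] at h2
    have h3 := sub_eq_zero.1 h2.symm
    have h4 : U * zr (X x) =
        U * ((s x)⁻¹ • (((hv (u x))ᴴ * zr (X x)) 0 0 • hv (u x))) := by
      rw [← mul_one_one]
      conv_lhs => rw [h3, hPw', hw]
      simp only [Matrix.smul_mul, Matrix.mul_smul, Matrix.conjTranspose_mul, Matrix.mul_assoc,
        hUU']
    have h5 := congrArg (fun M => Uᴴ * M) h4
    simp only [hUU'] at h5
    simp only [hv_mul] at h5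
    have h6 := congrFun (congrFun h5 (Sum.inl 0)) 0
    simp [zr, hv] at h6
    have h7 : ((u x)ᴴ * X x) 0 0 = 0 := by
      rcases h6 with h6 | h6
      · exact absurd h6 (hs0 x)
      · exact h6
    ext i j
    have h8 := congrFun (congrFun h5 (Sum.inr i)) j
    simpa [h7, zr] using h8
  · intro h
    have h1 := d6 x
    rw [h, zr, Matrix.fromRows_zero, Matrix.mul_zero, Matrix.mul_zero] at h1
    have h2 := (smul_eq_zero.1 h1).resolve_left (hs0 x)
    rw [Matrix.sub_mul, Matrix.one_mul] at h2
    have h3 := sub_eq_zero.1 h2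
    have h4 : P x * boxM P x * P x = boxM P x * P x := by
      have h : P x * boxM P x * ((s x)⁻¹ • (w x * (w x)ᴴ)) =
          boxM P x * ((s x)⁻¹ • (w x * (w x)ᴴ)) := by
        rw [Matrix.mul_smul, Matrix.mul_smul, ← Matrix.mul_assoc, ← Matrix.mul_assoc,
          Matrix.mul_assoc (P x), ← h3]
      rwa [← hPw' x] at h
    have h5 := congrArg Matrix.conjTranspose h4
    simp only [Matrix.conjTranspose_mul, hPH, hBH] at h5
    rw [← Matrix.mul_assoc] at h5
    rw [← h5, h4, sub_self]
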